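/- Consider the three-argument CAF F0 = ({a1, a2, φ}, {(φ, a2)}, cl) with cl(a1) = cl(a2) = a and cl(φ) = φ (a ≠ φ). The naive extensions of F0 are exactly {a1, φ} and {a1, a2}, its inherited naive semantics is na_c(F0) = {{a, φ}, {a}}, which is not incomparable since {a} ⊊ {a, φ}; consequently na_c(F0) ≠ cl-naive(F0), so F0 is a well-formed CAF that is not concurrent for naive semantics. -/

import Mathlib

/-- A set `E` of arguments is conflict-free w.r.t. attack relation `R`:
no argument in `E` attacks another argument in `E`. -/
def ConflictFree {α : Type*} (R : α → α → Prop) (E : Set α) : Prop :=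
  ∀ a ∈ E, ∀ b ∈ E, ¬ R a b

/-- A set `E` is naive iff it is ⊆-maximal among conflict-free sets. -/
def Naive {α : Type*} (R : α → α → Prop) (E : Set α) : Prop :=
  ConflictFree R E ∧ ∀ E', ConflictFree R E' → E ⊆ E' → E' = E

/-- Inherited naive semantics: claim-sets of naive extensions. -/
def naC {α γ : Type*} (R : α → α → Prop) (cl : α → γ) : Set (Set γ) :=
  {S | ∃ E, Naive R E ∧ S = cl '' E}

/-- Claim-sets of conflict-free sets. -/
def cfC {α γ : Type*} (R : α → α → Prop) (cl : α → γ) : Set (Set γ) :=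
  {S | ∃ E, ConflictFree R E ∧ S = cl '' E}

/-- Claim-level naive semantics: ⊆-maximal claim-sets of conflict-free sets. -/
def clNaive {α γ : Type*} (R : α → α → Prop) (cl : α → γ) : Set (Set γ) :=
  {S | S ∈ cfC R cl ∧ ∀ T ∈ cfC R cl, S ⊆ T → T = S}

/-- A family of sets is incomparable if no member is a strict subset of another. -/
def Incomparable {γ : Type*} (S : Set (Set γ)) : Prop :=
  ∀ S1 ∈ S, ∀ S2 ∈ S, ¬ S1 ⊂ S2

/-- The three arguments of the smallest non-concurrent CAF `F0`. -/
inductive Arg0 where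
  | a1 : Arg0
  | a2 : Arg0
  | phi : Arg0
deriving DecidableEq

/-- The two claims of `F0`: `a` (shared by `a1` and `a2`) and `φ`. -/
inductive Claim0 where
  | a : Claim0
  | phi : Claim0
deriving DecidableEq

/-- The claim function of `F0`: `cl(a1) = cl(a2) = a`, `cl(φ) = φ`. -/
def cl0 : Arg0 → Claim0
  | .a1 => .a
  | .a2 => .a
  | .phi => .phi

/-- The attack relation of `F0`: the single attack `(φ, a2)`. -/
def R0 : Arg0 → Arg0 → Prop := fun u v => u = Arg0.phi ∧ v = Arg0.a2

/-- The claim-level naive semantics is always incomparable. -/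
theorem incomparable_clNaive {α γ : Type*} (R : α → α → Prop) (cl : α → γ) :
    Incomparable (clNaive R cl) :=
  fun _ h₁ _ h₂ h => h.ne (h₁.2 _ h₂.1 h.subset).symm

theorem conflictFree_R0_iff {E : Set Arg0} :
    ConflictFree R0 E ↔ ¬ (Arg0.phi ∈ E ∧ Arg0.a2 ∈ E) := by
  constructor
  · exact fun h hE => h _ hE.1 _ hE.2 ⟨rfl, rfl⟩
  · rintro h _ ha _ hb ⟨rfl, rfl⟩
    exact h ⟨ha, hb⟩

theorem naive_R0_iff {E : Set Arg0} :
    Naive R0 E ↔ E = {Arg0.a1, Arg0.phi} ∨ E = {Arg0.a1, Arg0.a2} := by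
  constructor
  · rintro ⟨hE, hmax⟩
    rw [conflictFree_R0_iff] at hE
    by_cases h : Arg0.a2 ∈ E
    · refine .inr (hmax _ (by simp [conflictFree_R0_iff]) ?_).symm
      rintro (_ | _ | _) hx <;> simp_all
    · refine .inl (hmax _ (by simp [conflictFree_R0_iff]) ?_).symm
      rintro (_ | _ | _) hx <;> simp_all
  · rintro (rfl | rfl) <;> refine ⟨by simp [conflictFree_R0_iff], fun E' hE' hsub => ?_⟩ <;>
      rw [conflictFree_R0_iff] at hE' <;>
      rw [Set.insert_subset_iff, Set.singleton_subset_iff] at hsub <;>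
      ext (_ | _ | _) <;> simp_all

theorem naC_R0_cl0 : naC R0 cl0 = {{Claim0.a, Claim0.phi}, {Claim0.a}} := by
  ext S
  simp [naC, naive_R0_iff, or_and_right, exists_or, Set.image_insert_eq, cl0]

theorem singleton_ssubset_claims :
    ({Claim0.a} : Set Claim0) ⊂ {Claim0.a, Claim0.phi} := by
  simp [Set.ssubset_iff_subset_ne, Set.ext_iff]

theorem not_incomparable_naC_R0_cl0 : ¬ Incomparable (naC R0 cl0) := fun h =>
  h {Claim0.a} (by simp [naC_R0_cl0]) {Claim0.a, Claim0.phi} (by simp [naC_R0_cl0])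
    singleton_ssubset_claims

/-- For `F0 = ({a1, a2, φ}, {(φ, a2)}, cl)` with
`cl(a1) = cl(a2) = a` and `cl(φ) = φ`: its naive extensions are exactly
`{a1, φ}` and `{a1, a2}`, `na_c(F0) = {{a, φ}, {a}}` is not incomparable since
`{a} ⊊ {a, φ}`, hence `na_c(F0) ≠ cl-naive(F0)`, although `F0` is well-formed. -/
theorem smallest_nonconcurrent_caf :
    {E | Naive R0 E} = {{Arg0.a1, Arg0.phi}, {Arg0.a1, Arg0.a2}} ∧
    naC R0 cl0 = {{Claim0.a, Claim0.phi}, {Claim0.a}} ∧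
    ({Claim0.a} : Set Claim0) ⊂ {Claim0.a, Claim0.phi} ∧
    ¬ Incomparable (naC R0 cl0) ∧
    naC R0 cl0 ≠ clNaive R0 cl0 ∧
    (∀ u v : Arg0, cl0 u = cl0 v → ∀ w : Arg0, R0 u w ↔ R0 v w) := by
  refine ⟨Set.ext fun E => naive_R0_iff, naC_R0_cl0, singleton_ssubset_claims,
    not_incomparable_naC_R0_cl0, fun h => ?_, ?_⟩
  · exact not_incomparable_naC_R0_cl0 (h ▸ incomparable_clNaive R0 cl0)
  · rintro (_ | _ | _) (_ | _ | _) h w <;> simp_all [cl0, R0]
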